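/- Let d ≥ 1, λ > 3d/2 and λ' > λ + 1. There exists a constant C > 0, depending only on d, λ, λ', such that for every μ ∈ H^{λ'}(𝕋^d), every vector-valued kernel K ∈ L^1(𝕋^d; ℝ^d) and every f ∈ H^{-λ-1}(𝕋^d), the distribution ∇·(f (K*μ)) (divergence of the product of the distribution f with the ℝ^d-valued function K*μ) belongs to H^{-λ-2}(𝕋^d) and ‖∇·(f (K*μ))‖_{H^{-λ-2}(𝕋^d)} ≤ C ‖μ‖_{H^{λ'}(𝕋^d)} ‖f‖_{H^{-λ-1}(𝕋^d)} ‖K‖_{L^1(𝕋^d)}. -/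

import Mathlib

open MeasureTheory Complex Filter
open scoped BigOperators

noncomputable section
namespace PaperTorus

/-- The lattice `ℤ^d` of Fourier modes of the torus `𝕋^d = (ℝ/ℤ)^d`. -/
abbrev Lat (d : ℕ) := Fin d → ℤ

/-- A distribution `f` on the torus `𝕋^d`, encoded by the family of its pairings
`⟨f, e_k⟩ = f(e_k)` with the characters `e_k(x) = exp(2πi k·x)`, `k ∈ ℤ^d`. -/
abbrev Coef (d : ℕ) := Lat d → ℂ

/-- The Japanese bracket `⟨k⟩ = (1 + |k|²)^(1/2)`. -/
def jap {d : ℕ} (k : Lat d) : ℝ := Real.sqrt (1 + ∑ i, ((k i : ℝ)) ^ 2)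

/-- Membership `f ∈ Hˢ(𝕋^d)`: the series `Σ_k ⟨k⟩^(2s) |⟨f,e_k⟩|²` converges. -/
def MemSob {d : ℕ} (s : ℝ) (f : Coef d) : Prop :=
  Summable fun k : Lat d => jap k ^ (2 * s) * ‖f k‖ ^ 2

/-- The Sobolev norm `‖f‖_{Hˢ(𝕋^d)} = (Σ_k ⟨k⟩^(2s) |⟨f,e_k⟩|²)^(1/2)`. -/
def sobNorm {d : ℕ} (s : ℝ) (f : Coef d) : ℝ :=
  Real.sqrt (∑' k : Lat d, jap k ^ (2 * s) * ‖f k‖ ^ 2)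

/-- The inner product `⟨f,g⟩_{Hˢ(𝕋^d)} = Σ_k ⟨k⟩^(2s) ⟨f,e_k⟩ conj(⟨g,e_k⟩)`. -/
def sobInner {d : ℕ} (s : ℝ) (f g : Coef d) : ℂ :=
  ∑' k : Lat d, ((jap k ^ (2 * s) : ℝ) : ℂ) * f k * (starRingEnd ℂ) (g k)

/-- The fundamental domain `[0,1)^d` of the torus `𝕋^d`. -/
def box (d : ℕ) : Set (Fin d → ℝ) := Set.univ.pi fun _ => Set.Ico (0 : ℝ) 1

/-- `ℤ^d`-periodicity: `g` is (the lift of) a function on the torus `𝕋^d`. -/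
def TorusFun {d : ℕ} {α : Type*} (g : (Fin d → ℝ) → α) : Prop :=
  ∀ (x : Fin d → ℝ) (m : Lat d), g (fun i => x i + (m i : ℝ)) = g x

/-- The character `e_k(x) = exp(2πi k·x)` on the torus. -/
def eChar {d : ℕ} (k : Lat d) (x : Fin d → ℝ) : ℂ :=
  Complex.exp (2 * (Real.pi : ℂ) * Complex.I * ∑ i, (k i : ℂ) * (x i : ℂ))

/-- The pairing `⟨g, e_k⟩ = ∫_{𝕋^d} g e_k` of an integrable function `g` on the
torus with the character `e_k`; for `g ∈ L¹(𝕋^d)` this encodes `g` as a distribution. -/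
def fCoef {d : ℕ} (g : (Fin d → ℝ) → ℂ) (k : Lat d) : ℂ :=
  ∫ x in box d, g x * eChar k x

/-- Pairings of the distributional partial derivative:
`⟨∂_{x_j} f, e_k⟩ = -⟨f, ∂_{x_j} e_k⟩ = -2πi k_j ⟨f, e_k⟩`. -/
def pderivCoef {d : ℕ} (j : Fin d) (f : Coef d) : Coef d :=
  fun k => -(2 * (Real.pi : ℂ) * Complex.I * (k j : ℂ)) * f k

/-- Pairings of the product `a·b` of a function `a` with a distribution `b` (both
encoded by their pairings with the characters): `⟨a·b, e_k⟩ = Σ_l ⟨a,e_l⟩⟨b,e_{k-l}⟩`. -/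
def prodCoef {d : ℕ} (a b : Coef d) : Coef d :=
  fun k => ∑' l : Lat d, a l * b (k - l)

/-- Pairings of the divergence `∇·v` of a vector of distributions. -/
def divCoef {d : ℕ} (v : Fin d → Coef d) : Coef d :=
  fun k => ∑ j, pderivCoef j (v j) k

/-! ### Helper lemmas -/

lemma jap_one_le {d : ℕ} (k : Lat d) : 1 ≤ jap k := by
  unfold jap
  rw [Real.one_le_sqrt]
  have : 0 ≤ ∑ i, ((k i : ℝ)) ^ 2 := Finset.sum_nonneg fun i _ => sq_nonneg _
  linarith

lemma jap_pos {d : ℕ} (k : Lat d) : 0 < jap k := lt_of_lt_of_le one_pos (jap_one_le k)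

lemma abs_le_jap {d : ℕ} (k : Lat d) (j : Fin d) : |(k j : ℝ)| ≤ jap k := by
  unfold jap
  apply Real.abs_le_sqrt
  have := Finset.single_le_sum (f := fun i => ((k i : ℝ)) ^ 2) (fun i _ => sq_nonneg _)
    (Finset.mem_univ j)
  linarith

/-- `⟨l⟩ ≤ 2 max(⟨k⟩, ⟨k-l⟩)`. -/
lemma jap_le_max {d : ℕ} (k l : Lat d) : jap l ≤ 2 * max (jap k) (jap (k - l)) := by
  have h1 : jap l ^ 2 ≤ 2 * (jap k ^ 2 + jap (k - l) ^ 2) := by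
    have h0 : ∀ m : Lat d, jap m ^ 2 = 1 + ∑ i, ((m i : ℝ)) ^ 2 := fun m => by
      unfold jap
      exact Real.sq_sqrt (by positivity)
    simp only [h0]
    have : ∑ i, ((l i : ℝ)) ^ 2 ≤
        ∑ i, (2 * ((k i : ℝ)) ^ 2 + 2 * (((k - l) i : ℤ) : ℝ) ^ 2) := by
      apply Finset.sum_le_sum
      intro i _
      simp only [Pi.sub_apply, Int.cast_sub]
      nlinarith [sq_nonneg (2 * (k i : ℝ) - l i)]
    rw [Finset.sum_add_distrib, ← Finset.mul_sum, ← Finset.mul_sum] at this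
    linarith
  have hk := jap_pos k
  have hm := jap_pos (k - l)
  set M := max (jap k) (jap (k - l))
  have a1 : jap k ≤ M := le_max_left _ _
  have a2 : jap (k - l) ≤ M := le_max_right _ _
  refine le_of_pow_le_pow_left₀ two_ne_zero (by linarith) ?_
  nlinarith [jap_pos l]

lemma jap_rpow_le {d : ℕ} {s : ℝ} (hs : 0 ≤ s) (k l : Lat d) :
    jap l ^ s ≤ 2 ^ s * (jap k ^ s + jap (k - l) ^ s) := by
  have hk := jap_pos k
  have hm := jap_pos (k - l)
  calc jap l ^ s ≤ (2 * max (jap k) (jap (k - l))) ^ s :=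
        Real.rpow_le_rpow (jap_pos l).le (jap_le_max k l) hs
    _ = 2 ^ s * max (jap k) (jap (k - l)) ^ s :=
        Real.mul_rpow (by norm_num) (le_max_of_le_left hk.le)
    _ ≤ _ := by
        gcongr
        have p1 : 0 ≤ jap k ^ s := by positivity
        have p2 : 0 ≤ jap (k - l) ^ s := by positivity
        rcases max_cases (jap k) (jap (k - l)) with h | h <;> rw [h.1] <;> linarith

lemma summable_jap {d : ℕ} (r : ℝ) (hr : r < -(d : ℝ)) :
    Summable fun k : Lat d => jap k ^ r := by
  let b := Pi.basisFun ℝ (Fin d)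
  let L := Submodule.span ℤ (Set.range b)
  have hrank : Module.finrank ℤ L = d := by
    rw [ZLattice.rank ℝ L]; simp
  have h1 : Summable fun z : L => ‖z‖ ^ r :=
    ZLattice.summable_norm_rpow L r (by rw [hrank]; exact hr)
  have hmem : ∀ k : Lat d, (fun i => (k i : ℝ)) ∈ L := by
    intro k
    rw [b.mem_span_iff_repr_mem ℤ]
    intro i
    exact ⟨k i, by simp [b]⟩
  let φ : Lat d → L := fun k => ⟨fun i => (k i : ℝ), hmem k⟩
  have hφ : Function.Injective φ := by
    intro k k' h
    have := congrArg Subtype.val h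
    ext i
    have := congrFun this i
    simpa [φ] using this
  have h2 := h1.comp_injective hφ
  have h3 : Summable fun k : Lat d => if k = 0 then (1 : ℝ) else 0 :=
    (hasSum_ite_eq (0 : Lat d) (1 : ℝ)).summable
  refine Summable.of_nonneg_of_le (fun k => Real.rpow_nonneg (jap_pos k).le _) ?_ (h2.add h3)
  intro k
  have hr0 : r ≤ 0 := by
    have : (0 : ℝ) ≤ d := Nat.cast_nonneg d
    linarith
  by_cases hk : k = 0
  · have : jap k ^ r ≤ 1 := Real.rpow_le_one_of_one_le_of_nonpos (jap_one_le k) hr0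
    have h0 : 0 ≤ ‖φ k‖ ^ r := by positivity
    simp only [Function.comp, hk, if_true] at *
    linarith
  · simp only [Function.comp, hk, if_false, add_zero]
    have hpos : 0 < ‖φ k‖ := by
      rw [norm_pos_iff]
      intro h
      apply hk
      apply hφ
      rw [h]
      ext i
      simp [φ]
    apply Real.rpow_le_rpow_of_nonpos hpos _ hr0
    change ‖(fun i => (k i : ℝ))‖ ≤ jap k
    rw [pi_norm_le_iff_of_nonneg (jap_pos k).le]
    intro i
    exact abs_le_jap k i

/-- Cauchy-Schwarz for series. -/
lemma cs_tsum {ι : Type*} {a b : ι → ℝ} (ha : ∀ i, 0 ≤ a i) (hb : ∀ i, 0 ≤ b i)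
    (hA : Summable fun i => a i ^ 2) (hB : Summable fun i => b i ^ 2) :
    (Summable fun i => a i * b i) ∧
      (∑' i, a i * b i) ^ 2 ≤ (∑' i, a i ^ 2) * ∑' i, b i ^ 2 := by
  have h := Real.summable_and_inner_le_Lp_mul_Lq_tsum_of_nonneg Real.HolderConjugate.two_two ha hb
    (by simpa using hA) (by simpa using hB)
  refine ⟨h.1, ?_⟩
  have h2 := h.2
  simp only [Real.rpow_two, ← Real.sqrt_eq_rpow] at h2
  have p : 0 ≤ ∑' i, a i * b i := tsum_nonneg fun i => mul_nonneg (ha i) (hb i)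
  calc (∑' i, a i * b i) ^ 2 ≤ (√(∑' i, a i ^ 2) * √(∑' i, b i ^ 2)) ^ 2 := by gcongr
    _ = _ := by
      rw [mul_pow, Real.sq_sqrt (tsum_nonneg fun i => sq_nonneg _),
        Real.sq_sqrt (tsum_nonneg fun i => sq_nonneg _)]

/-- The equivalence `(k,l) ↦ (l,k-l)`. -/
def shearEquiv (d : ℕ) : Lat d × Lat d ≃ Lat d × Lat d where
  toFun p := (p.2, p.1 - p.2)
  invFun q := (q.1 + q.2, q.1)
  left_inv p := by simp
  right_inv q := by simp

lemma conv_summable {d : ℕ} {A B : Lat d → ℝ} (hA0 : ∀ k, 0 ≤ A k) (hB0 : ∀ k, 0 ≤ B k)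
    (hA : Summable A) (hB : Summable B) :
    (∀ k, Summable fun l => A l * B (k - l)) ∧
    (Summable fun k => ∑' l, A l * B (k - l)) ∧
    ∑' k, ∑' l, A l * B (k - l) = (∑' k, A k) * ∑' k, B k := by
  have h := hA.mul_of_nonneg hB hA0 hB0
  have h' : Summable fun p : Lat d × Lat d => A p.2 * B (p.1 - p.2) :=
    (shearEquiv d).summable_iff.2 h
  refine ⟨fun k => h'.prod_factor k, h'.prod, ?_⟩
  rw [← h'.tsum_prod, hA.tsum_mul_tsum hB h]
  exact (shearEquiv d).tsum_eq (fun x : Lat d × Lat d => A x.1 * B x.2)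

/-- The main bilinear estimate. -/
lemma core {d : ℕ} {s : ℝ} (hs : (d : ℝ) < 2 * s) {u v : Lat d → ℝ}
    (hu0 : ∀ k, 0 ≤ u k) (hv0 : ∀ k, 0 ≤ v k)
    (hu : Summable fun k => jap k ^ (2 * (-s)) * u k ^ 2)
    (hv : Summable fun k => jap k ^ (2 * s) * v k ^ 2) :
    (∀ k, Summable fun l => u l * v (k - l)) ∧
    (Summable fun k => jap k ^ (2 * (-s)) * (∑' l, u l * v (k - l)) ^ 2) ∧
    ∑' k, jap k ^ (2 * (-s)) * (∑' l, u l * v (k - l)) ^ 2 ≤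
      (4 * (2 ^ s) ^ 2 * ∑' k : Lat d, jap k ^ (2 * (-s))) *
        (∑' k, jap k ^ (2 * s) * v k ^ 2) * ∑' k, jap k ^ (2 * (-s)) * u k ^ 2 := by
  have hs0 : 0 ≤ s := by
    have : (0 : ℝ) ≤ d := Nat.cast_nonneg d
    linarith
  set w : Lat d → ℝ := fun k => jap k ^ (-s) with hw
  have hsq : ∀ (t : ℝ) (k : Lat d), (jap k ^ t) ^ 2 = jap k ^ (2 * t) := fun t k => by
    rw [← Real.rpow_natCast, ← Real.rpow_mul (jap_pos k).le, mul_comm]; norm_num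
  have hw2 : ∀ k, w k ^ 2 = jap k ^ (2 * (-s)) := fun k => hsq _ k
  have hw0 : ∀ k, 0 < w k := fun k => Real.rpow_pos_of_pos (jap_pos k) _
  have hW : Summable fun k => w k ^ 2 := by
    simp only [hw2]
    exact summable_jap _ (by linarith)
  have hwinv : ∀ k, w k * jap k ^ s = 1 := fun k => by
    simp only [hw]
    rw [← Real.rpow_add (jap_pos k)]; simp
  set F : Lat d → ℝ := fun k => w k * u k with hF
  set G : Lat d → ℝ := fun k => jap k ^ s * v k with hG
  have hF0 : ∀ k, 0 ≤ F k := fun k => mul_nonneg (hw0 k).le (hu0 k)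
  have hG0 : ∀ k, 0 ≤ G k := fun k => mul_nonneg (Real.rpow_nonneg (jap_pos k).le _) (hv0 k)
  have hF2 : ∀ k, jap k ^ (2 * (-s)) * u k ^ 2 = F k ^ 2 := fun k => by
    simp only [hF, mul_pow, hw2]
  have hG2 : ∀ k, jap k ^ (2 * s) * v k ^ 2 = G k ^ 2 := fun k => by
    simp only [hG, mul_pow, hsq]
  simp only [hF2, hG2] at hu hv ⊢
  simp only [← hw2]
  have hsub : ∀ k : Lat d, ∀ H : Lat d → ℝ, Summable H → Summable fun l => H (k - l) :=
    fun k H hH => (Equiv.subLeft k).summable_iff.2 hH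
  have hsubt : ∀ k : Lat d, ∀ H : Lat d → ℝ, ∑' l, H (k - l) = ∑' l, H l :=
    fun k H => (Equiv.subLeft k).tsum_eq H
  have hconv := conv_summable (A := fun k => F k ^ 2) (B := fun k => G k ^ 2)
    (fun k => sq_nonneg _) (fun k => sq_nonneg _) hu hv
  have hY : ∀ k, _ := fun k => cs_tsum hF0 (fun l => hG0 (k - l)) hu (hsub k _ hv)
  have hX : ∀ k, _ := fun k => cs_tsum (a := fun l => w (k - l)) (b := fun l => F l * G (k - l))
    (fun l => (hw0 (k - l)).le) (fun l => mul_nonneg (hF0 l) (hG0 (k - l)))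
    (hsub k _ hW) (by simpa only [mul_pow] using hconv.1 k)
  have hpt : ∀ k l, w k * (u l * v (k - l)) ≤
      2 ^ s * (w (k - l) * (F l * G (k - l)) + w k * (F l * G (k - l))) := by
    intro k l
    have e1 : u l = jap l ^ s * F l := by
      simp only [hF]; rw [← mul_assoc, mul_comm (jap l ^ s), hwinv, one_mul]
    have e2 : v (k - l) = w (k - l) * G (k - l) := by
      simp only [hG]; rw [← mul_assoc, hwinv, one_mul]
    have key : w k * w (k - l) * jap l ^ s ≤ 2 ^ s * (w (k - l) + w k) := by
      have := mul_le_mul_of_nonneg_left (jap_rpow_le hs0 k l)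
        (mul_nonneg (hw0 k).le (hw0 (k - l)).le)
      refine this.trans (le_of_eq ?_)
      have a := hwinv k
      have b := hwinv (k - l)
      linear_combination (2 ^ s * w (k - l)) * a + (2 ^ s * w k) * b
    have := mul_le_mul_of_nonneg_right key (mul_nonneg (hF0 l) (hG0 (k - l)))
    rw [e1, e2]
    calc _ = w k * w (k - l) * jap l ^ s * (F l * G (k - l)) := by ring
      _ ≤ _ := this
      _ = _ := by ring
  have hsum : ∀ k, Summable fun l => 2 ^ s * (w (k - l) * (F l * G (k - l)) +
      w k * (F l * G (k - l))) := fun k =>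
    (((hX k).1).add ((hY k).1.mul_left (w k))).mul_left _
  have hP : ∀ k, Summable fun l => u l * v (k - l) := by
    intro k
    have : Summable fun l => w k * (u l * v (k - l)) :=
      Summable.of_nonneg_of_le (fun l => mul_nonneg (hw0 k).le (mul_nonneg (hu0 l) (hv0 _)))
        (hpt k) (hsum k)
    exact (summable_mul_left_iff (hw0 k).ne').1 this
  set W := ∑' k, w k ^ 2 with hWdef
  set A := ∑' k, F k ^ 2 with hAdef
  set B := ∑' k, G k ^ 2 with hBdef
  have hbd : ∀ k, w k ^ 2 * (∑' l, u l * v (k - l)) ^ 2 ≤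
      2 * (2 ^ s) ^ 2 * (W * (∑' l, F l ^ 2 * G (k - l) ^ 2) + w k ^ 2 * (A * B)) := by
    intro k
    have h1 : w k * ∑' l, u l * v (k - l) ≤
        2 ^ s * ((∑' l, w (k - l) * (F l * G (k - l))) + w k * ∑' l, F l * G (k - l)) := by
      rw [← tsum_mul_left, ← tsum_mul_left, ← ((hX k).1).tsum_add ((hY k).1.mul_left (w k)),
        ← tsum_mul_left]
      exact ((hP k).mul_left (w k)).tsum_le_tsum (hpt k) (hsum k)
    have h2 := (hX k).2
    have h3 := (hY k).2
    rw [hsubt k (fun l => w l ^ 2)] at h2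
    rw [hsubt k (fun l => G l ^ 2)] at h3
    simp only [mul_pow] at h2
    have h0 : 0 ≤ w k * ∑' l, u l * v (k - l) :=
      mul_nonneg (hw0 k).le (tsum_nonneg fun l => mul_nonneg (hu0 l) (hv0 _))
    set X := ∑' l, w (k - l) * (F l * G (k - l))
    set Y := ∑' l, F l * G (k - l)
    have h4 : w k ^ 2 * Y ^ 2 ≤ w k ^ 2 * (A * B) := by gcongr
    calc w k ^ 2 * (∑' l, u l * v (k - l)) ^ 2 = (w k * ∑' l, u l * v (k - l)) ^ 2 := by ring
      _ ≤ (2 ^ s * (X + w k * Y)) ^ 2 := by gcongr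
      _ ≤ (2 ^ s) ^ 2 * (2 * (X ^ 2 + w k ^ 2 * Y ^ 2)) := by
        rw [mul_pow]
        gcongr
        nlinarith [sq_nonneg (X - w k * Y)]
      _ ≤ (2 ^ s) ^ 2 * (2 * (W * (∑' l, F l ^ 2 * G (k - l) ^ 2) + w k ^ 2 * (A * B))) := by
        gcongr
      _ = _ := by ring
  have hsum1 := hconv.2.1.mul_left W
  have hsum2 := hW.mul_right (A * B)
  have hsum3 := (hsum1.add hsum2).mul_left (2 * (2 ^ s) ^ 2)
  have hfin : Summable fun k => w k ^ 2 * (∑' l, u l * v (k - l)) ^ 2 :=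
    Summable.of_nonneg_of_le (fun k => by positivity) hbd hsum3
  refine ⟨hP, hfin, (hfin.tsum_le_tsum hbd hsum3).trans (le_of_eq ?_)⟩
  rw [tsum_mul_left, hsum1.tsum_add hsum2, tsum_mul_left, tsum_mul_right, hconv.2.2]
  ring

lemma norm_eChar {d : ℕ} (k : Lat d) (x : Fin d → ℝ) : ‖eChar k x‖ = 1 := by
  unfold eChar
  have : 2 * (Real.pi : ℂ) * Complex.I * ∑ i, (k i : ℂ) * (x i : ℂ) =
      ((2 * Real.pi * ∑ i, (k i : ℝ) * x i : ℝ) : ℂ) * Complex.I := by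
    push_cast; ring
  rw [this, Complex.norm_exp_ofReal_mul_I]

lemma fCoef_le {d : ℕ} (K : (Fin d → ℝ) → Fin d → ℝ)
    (hK : ∀ j, IntegrableOn (fun x => K x j) (box d)) (j : Fin d) (k : Lat d) :
    ‖fCoef (fun x => (K x j : ℂ)) k‖ ≤ ∫ x in box d, Real.sqrt (∑ j, K x j ^ 2) := by
  unfold fCoef
  have hint : Integrable (fun x => Real.sqrt (∑ j, K x j ^ 2)) (volume.restrict (box d)) := by
    have h1 : Integrable (fun x => ∑ j, |K x j|) (volume.restrict (box d)) :=
      integrable_finsetSum _ fun j _ => (hK j).abs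
    refine h1.mono' ?_ (Filter.Eventually.of_forall fun x => ?_)
    · have : AEMeasurable (fun x => ∑ j, K x j ^ 2) (volume.restrict (box d)) :=
        Finset.aemeasurable_fun_sum _ fun j _ => (hK j).aestronglyMeasurable.aemeasurable.pow_const 2
      exact this.sqrt.aestronglyMeasurable
    · rw [Real.norm_of_nonneg (Real.sqrt_nonneg _)]
      apply Real.sqrt_le_iff.2 ⟨Finset.sum_nonneg fun i _ => abs_nonneg _, ?_⟩
      have := Finset.sum_sq_le_sq_sum_of_nonneg (s := Finset.univ) (f := fun j => |K x j|)
        (fun i _ => abs_nonneg _)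
      simpa using this
  refine norm_integral_le_of_norm_le hint (Filter.Eventually.of_forall fun x => ?_)
  rw [norm_mul, norm_eChar, mul_one, Complex.norm_real]
  apply Real.abs_le_sqrt
  exact Finset.single_le_sum (f := fun i => K x i ^ 2) (fun i _ => sq_nonneg _)
    (Finset.mem_univ j)

/-- for `d ≥ 1`, `λ > 3d/2`, `λ' > λ+1` there is `C = C(d,λ,λ') > 0` such
that for every `μ ∈ H^{λ'}(𝕋^d)`, every kernel `K ∈ L¹(𝕋^d; ℝ^d)` and every
`f ∈ H^{-λ-1}(𝕋^d)`, the distribution `∇·(f (K*μ))` belongs to `H^{-λ-2}(𝕋^d)` and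
`‖∇·(f (K*μ))‖_{H^{-λ-2}} ≤ C ‖μ‖_{H^{λ'}} ‖f‖_{H^{-λ-1}} ‖K‖_{L¹}`.
Here `⟨K*μ, e_k⟩ = (∫ K e_k) ⟨μ, e_k⟩` componentwise, and the product of the
distribution `f` with the function `K*μ` and the divergence are taken via
`prodCoef` and `divCoef`. -/
theorem statement1
    (d : ℕ) (hd : 1 ≤ d) (lam lam' : ℝ)
    (hlam : 3 * (d : ℝ) / 2 < lam) (hlam' : lam + 1 < lam') :
    ∃ C : ℝ, 0 < C ∧
      ∀ (μ : Coef d) (K : (Fin d → ℝ) → Fin d → ℝ) (f : Coef d),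
        MemSob lam' μ → TorusFun K →
        (∀ j, IntegrableOn (fun x => K x j) (box d)) →
        MemSob (-(lam + 1)) f →
        (∀ (j : Fin d) (k : Lat d),
            Summable fun l : Lat d =>
              f l * (fCoef (fun x => (K x j : ℂ)) (k - l) * μ (k - l))) ∧
        MemSob (-(lam + 2))
          (divCoef fun j => prodCoef f fun m => fCoef (fun x => (K x j : ℂ)) m * μ m) ∧
        sobNorm (-(lam + 2))
            (divCoef fun j => prodCoef f fun m => fCoef (fun x => (K x j : ℂ)) m * μ m)
          ≤ C * sobNorm lam' μ * sobNorm (-(lam + 1)) f *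
              ∫ x in box d, Real.sqrt (∑ j, K x j ^ 2) := by
  set s := lam + 1 with hs
  have hd0 : (1 : ℝ) ≤ d := by exact_mod_cast hd
  have hsd : (d : ℝ) < 2 * s := by linarith
  set c : ℝ := 4 * (2 ^ s) ^ 2 * ∑' k : Lat d, jap k ^ (2 * (-s)) with hc
  have hc0 : 0 ≤ c :=
    mul_nonneg (by positivity) (tsum_nonneg fun k => Real.rpow_nonneg (jap_pos k).le _)
  refine ⟨2 * Real.pi * d * Real.sqrt c + 1, by positivity, ?_⟩
  intro μ K f hμ _ hK hf
  set I := ∫ x in box d, Real.sqrt (∑ j, K x j ^ 2) with hI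
  have hI0 : 0 ≤ I := integral_nonneg fun x => Real.sqrt_nonneg _
  have hle : ∀ k, jap k ^ (2 * s) * ‖μ k‖ ^ 2 ≤ jap k ^ (2 * lam') * ‖μ k‖ ^ 2 := fun k => by
    gcongr
    exact jap_one_le k
  have hμs : Summable fun k => jap k ^ (2 * s) * ‖μ k‖ ^ 2 :=
    Summable.of_nonneg_of_le
      (fun k => mul_nonneg (Real.rpow_nonneg (jap_pos k).le _) (sq_nonneg _)) hle hμ
  obtain ⟨hP, hQ, hR⟩ := core hsd (u := fun k => ‖f k‖) (v := fun k => ‖μ k‖)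
    (fun k => norm_nonneg _) (fun k => norm_nonneg _) hf hμs
  have hterm : ∀ j (k l : Lat d), ‖f l * (fCoef (fun x => (K x j : ℂ)) (k - l) * μ (k - l))‖ ≤
      I * (‖f l‖ * ‖μ (k - l)‖) := by
    intro j k l
    rw [norm_mul, norm_mul]
    have := fCoef_le K hK j (k - l)
    calc _ ≤ ‖f l‖ * (I * ‖μ (k - l)‖) := by gcongr
      _ = _ := by ring
  set P : Lat d → ℝ := fun k => ∑' l, ‖f l‖ * ‖μ (k - l)‖ with hPdef
  have hP0 : ∀ k, 0 ≤ P k := fun k => tsum_nonneg fun l => by positivity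
  set D := divCoef fun j => prodCoef f fun m => fCoef (fun x => (K x j : ℂ)) m * μ m with hD
  have hprod : ∀ j k, ‖prodCoef f (fun m => fCoef (fun x => (K x j : ℂ)) m * μ m) k‖ ≤ I * P k := by
    intro j k
    unfold prodCoef
    simp only [hPdef]
    rw [← tsum_mul_left]
    exact tsum_of_norm_bounded ((hP k).mul_left I).hasSum (hterm j k)
  have hDk : ∀ k, ‖D k‖ ≤ 2 * Real.pi * d * I * (jap k * P k) := by
    intro k
    simp only [hD, divCoef, pderivCoef]
    calc _ ≤ ∑ j : Fin d, 2 * Real.pi * I * (jap k * P k) := by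
          refine norm_sum_le_of_le _ fun j _ => ?_
          rw [norm_mul, norm_neg]
          have e : ‖2 * (Real.pi : ℂ) * Complex.I * (k j : ℂ)‖ = 2 * Real.pi * |(k j : ℝ)| := by
            simp [abs_of_pos Real.pi_pos]
          rw [e]
          have h1 := hprod j k
          have h2 := abs_le_jap k j
          have h3 := hP0 k
          have h4 := (jap_pos k).le
          calc _ ≤ 2 * Real.pi * jap k * (I * P k) := by gcongr
            _ = _ := by ring
      _ = _ := by
          rw [Finset.sum_const, Finset.card_univ, Fintype.card_fin, nsmul_eq_mul]; ring
  have hDb : ∀ k, jap k ^ (2 * (-(lam + 2))) * ‖D k‖ ^ 2 ≤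
      (2 * Real.pi * d * I) ^ 2 * (jap k ^ (2 * (-s)) * P k ^ 2) := by
    intro k
    have e : jap k ^ (2 * (-(lam + 2))) * jap k ^ 2 = jap k ^ (2 * (-s)) := by
      rw [← Real.rpow_natCast (jap k) 2, ← Real.rpow_add (jap_pos k)]
      congr 1
      push_cast
      rw [hs]; ring
    have h0 : 0 ≤ jap k ^ (2 * (-(lam + 2))) := Real.rpow_nonneg (jap_pos k).le _
    have h1 := hDk k
    calc _ ≤ jap k ^ (2 * (-(lam + 2))) * (2 * Real.pi * d * I * (jap k * P k)) ^ 2 := by gcongr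
      _ = _ := by rw [← e]; ring
  have hsumb := hQ.mul_left ((2 * Real.pi * d * I) ^ 2)
  have hmem : Summable fun k => jap k ^ (2 * (-(lam + 2))) * ‖D k‖ ^ 2 :=
    Summable.of_nonneg_of_le
      (fun k => mul_nonneg (Real.rpow_nonneg (jap_pos k).le _) (sq_nonneg _)) hDb hsumb
  refine ⟨fun j k => Summable.of_norm_bounded ((hP k).mul_left I) (hterm j k), hmem, ?_⟩
  have hA : ∑' k, jap k ^ (2 * s) * ‖μ k‖ ^ 2 ≤ ∑' k, jap k ^ (2 * lam') * ‖μ k‖ ^ 2 :=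
    hμs.tsum_le_tsum hle hμ
  have hF0 : 0 ≤ ∑' k, jap k ^ (2 * (-s)) * ‖f k‖ ^ 2 :=
    tsum_nonneg fun k => mul_nonneg (Real.rpow_nonneg (jap_pos k).le _) (sq_nonneg _)
  have hM0 : 0 ≤ ∑' k, jap k ^ (2 * lam') * ‖μ k‖ ^ 2 :=
    tsum_nonneg fun k => mul_nonneg (Real.rpow_nonneg (jap_pos k).le _) (sq_nonneg _)
  have htot : ∑' k, jap k ^ (2 * (-(lam + 2))) * ‖D k‖ ^ 2 ≤
      (2 * Real.pi * d * I) ^ 2 * (c * (∑' k, jap k ^ (2 * lam') * ‖μ k‖ ^ 2) *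
        ∑' k, jap k ^ (2 * (-s)) * ‖f k‖ ^ 2) := by
    refine (hmem.tsum_le_tsum hDb hsumb).trans ?_
    rw [tsum_mul_left]
    gcongr
    refine hR.trans ?_
    gcongr
  unfold sobNorm
  set M := ∑' k, jap k ^ (2 * lam') * ‖μ k‖ ^ 2
  set N := ∑' k, jap k ^ (2 * (-s)) * ‖f k‖ ^ 2
  calc _ ≤ Real.sqrt ((2 * Real.pi * d * I) ^ 2 * (c * M * N)) := Real.sqrt_le_sqrt htot
    _ = (2 * Real.pi * d * Real.sqrt c) * Real.sqrt M * Real.sqrt N * I := by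
      rw [Real.sqrt_mul (sq_nonneg _), Real.sqrt_sq (by positivity),
        Real.sqrt_mul (mul_nonneg hc0 hM0), Real.sqrt_mul hc0]
      ring
    _ ≤ _ := by
      gcongr
      linarith

end PaperTorus
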